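/- Let D be a semilocal finite-dimensional Prüfer domain, let P ∈ hiSpec(D) with P ≠ (0), and let Q be the element of hiSpec(D) directly below P. Let Δ := {A ∈ Spec(D) : Q ⊊ A ⊆ P}, let ℐ be the set of nonzero idempotent prime ideals of D (primes A with A = A²) and 𝒩 the set of nonzero nonidempotent prime ideals of D. Then ω(P) = Σ_{A∈Δ} ε(A) = |Δ ∩ 𝒩| + 2·|Δ ∩ ℐ|. -/

import Mathlib

/- Common background: Prüfer domains, semistar and (fractional) star operations,
standard decomposition, skeleton, supports, `hiSpec`, the rings `Z(P)`,
and the invariants `ω` and `ε`, following Spirito,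
"Semistar operations on semilocal Prüfer domains". -/

set_option linter.unusedSectionVars false
set_option maxHeartbeats 1000000

open Pointwise

noncomputable section

namespace Paper

variable (D : Type*) [CommRing D] [IsDomain D]
variable (K : Type*) [Field K] [Algebra D K] [IsFractionRing D K]

/-- The localization of `D` at a prime ideal `P`, viewed as an overring of `D`
inside its quotient field `K`. -/
def locAt (P : Ideal D) (hP : P.IsPrime) : Subalgebra D K :=
  Localization.subalgebra K (@Ideal.primeCompl D _ P hP)
    (fun _ hx => mem_nonZeroDivisors_of_ne_zero fun h => hx (h ▸ P.zero_mem))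

/-- A Prüfer domain: every localization at a prime ideal is a valuation domain
(any two elements are comparable w.r.t. divisibility). -/
def IsPrufer : Prop :=
  ∀ (P : Ideal D) (hP : P.IsPrime), ∀ x y : locAt D K P hP, ∃ z, x * z = y ∨ y * z = x

/-- A semilocal ring: finitely many maximal ideals. -/
def IsSemilocal : Prop := {I : Ideal D | I.IsMaximal}.Finite

/-- Two ideals are dependent if some nonzero prime ideal is contained in both. -/
def Dependent (M N : Ideal D) : Prop :=
  ∃ P : Ideal D, P.IsPrime ∧ P ≠ ⊥ ∧ P ≤ M ∧ P ≤ N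

/-- The member of the standard decomposition corresponding to the dependence class
of the maximal ideal `M`: the intersection of the localizations of `D` at the
maximal ideals dependent on `M`. -/
def TOf (M : Ideal D) : Subalgebra D K :=
  sInf {A | ∃ (N : Ideal D) (hN : N.IsMaximal), Dependent D M N ∧ A = locAt D K N hN.isPrime}

/-- The standard decomposition of `D`. -/
def stdDecomp : Set (Subalgebra D K) :=
  {T | ∃ M : Ideal D, M.IsMaximal ∧ T = TOf D K M}

/-- The skeleton of `Over(D)`: all intersections of subsets of the standard
decomposition (including the empty intersection `K` and the total one `D`). -/
def SkOver : Set (Subalgebra D K) :=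
  {A | ∃ S ⊆ stdDecomp D K, A = sInf S}

/-- `I` is a fractional ideal of the overring `A` of `D`: it is an `A`-submodule
of `K` and `dI ⊆ A` for some nonzero `d ∈ K`. -/
def IsFracOf (A : Subalgebra D K) (I : Submodule D K) : Prop :=
  (∀ a ∈ A, ∀ x ∈ I, a * x ∈ I) ∧ ∃ d : K, d ≠ 0 ∧ ∀ x ∈ I, d * x ∈ A

end Paper

namespace Paper

/-- A semistar operation on a domain `R` with quotient field `K`: an extensive,
order-preserving, idempotent self-map of the set of `R`-submodules of `K` such
that `(xI)^⋆ = x·I^⋆` for every nonzero `x ∈ K`. -/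
structure Semistar (R : Type*) [CommRing R] (K : Type*) [Field K] [Algebra R K] where
  toFun : Submodule R K → Submodule R K
  le_star' : ∀ I, I ≤ toFun I
  mono' : ∀ ⦃I J⦄, I ≤ J → toFun I ≤ toFun J
  idem' : ∀ I, toFun (toFun I) = toFun I
  smul' : ∀ (x : K), x ≠ 0 → ∀ I,
    toFun (Submodule.span R {x} * I) = Submodule.span R {x} * toFun I

namespace Semistar

variable {R : Type*} [CommRing R] {K : Type*} [Field K] [Algebra R K]

theorem ext' {s t : Semistar R K} (h : s.toFun = t.toFun) : s = t := by
  cases s; cases t; cases h; rfl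

instance : PartialOrder (Semistar R K) where
  le s t := ∀ I, s.toFun I ≤ t.toFun I
  le_refl _ _ := le_rfl
  le_trans _ _ _ hab hbc I := (hab I).trans (hbc I)
  le_antisymm _ _ h h' := ext' (funext fun I => le_antisymm (h I) (h' I))

end Semistar

/-- The identity semistar operation `d`. -/
def dOp (R : Type*) [CommRing R] (K : Type*) [Field K] [Algebra R K] : Semistar R K where
  toFun I := I
  le_star' _ := le_rfl
  mono' _ _ h := h
  idem' _ := rfl
  smul' _ _ _ := rfl

end Paper

namespace Paper

variable (D : Type*) [CommRing D] [IsDomain D]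
variable (K : Type*) [Field K] [Algebra D K] [IsFractionRing D K]

/-- A fractional star operation on an overring `A` of `D` (inside `K`): a
semistar-like closure operation defined on the fractional ideals of `A`.
In particular `FracStar D K ⊥` is the set of fractional star operations on `D`. -/
structure FracStar (A : Subalgebra D K) where
  toFun : {I : Submodule D K // IsFracOf D K A I} → {I : Submodule D K // IsFracOf D K A I}
  le_star' : ∀ I, I.1 ≤ (toFun I).1
  mono' : ∀ I J, I.1 ≤ J.1 → (toFun I).1 ≤ (toFun J).1
  idem' : ∀ I, toFun (toFun I) = toFun I
  smul' : ∀ (x : K), x ≠ 0 → ∀ I J, J.1 = Submodule.span D {x} * I.1 →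
    (toFun J).1 = Submodule.span D {x} * (toFun I).1

namespace FracStar

variable {D K} {A : Subalgebra D K}

theorem ext' {s t : FracStar D K A} (h : s.toFun = t.toFun) : s = t := by
  cases s; cases t; cases h; rfl

instance : PartialOrder (FracStar D K A) where
  le s t := ∀ I, (s.toFun I).1 ≤ (t.toFun I).1
  le_refl _ _ := le_rfl
  le_trans _ _ _ hab hbc I := (hab I).trans (hbc I)
  le_antisymm _ _ h h' := ext' (funext fun I => Subtype.ext (le_antisymm (h I) (h' I)))

end FracStar

/-- A fractional star operation on the overring `A` is a *star operation* if it
closes `A` itself. -/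
def FracStar.IsStarOp {A : Subalgebra D K} (f : FracStar D K A) : Prop :=
  ∀ h : IsFracOf D K A (Subalgebra.toSubmodule A),
    (f.toFun ⟨Subalgebra.toSubmodule A, h⟩).1 = Subalgebra.toSubmodule A

/-- The support of a semistar operation on `D`: the elements `A` of the skeleton
such that `A^⋆` is a fractional ideal of `A`. -/
def supp (s : Semistar D K) : Set (Subalgebra D K) :=
  {A | A ∈ SkOver D K ∧ IsFracOf D K A (s.toFun (Subalgebra.toSubmodule A))}

/-- The image of an ideal of `D` inside `K`. -/
def idealToK (P : Ideal D) : Submodule D K := Submodule.map (Algebra.linearMap D K) P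

end Paper

namespace Paper

/-- An abstract fractional star operation on a commutative ring `A`, acting on
the fractional ideals of `A` inside its fraction ring. -/
structure AFracStar (A : Type*) [CommRing A] where
  toFun : FractionalIdeal (nonZeroDivisors A) (FractionRing A) →
    FractionalIdeal (nonZeroDivisors A) (FractionRing A)
  le_star' : ∀ I, I ≤ toFun I
  mono' : ∀ ⦃I J⦄, I ≤ J → toFun I ≤ toFun J
  idem' : ∀ I, toFun (toFun I) = toFun I
  smul' : ∀ (x : FractionRing A), x ≠ 0 → ∀ I,
    toFun (FractionalIdeal.spanSingleton (nonZeroDivisors A) x * I) =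
      FractionalIdeal.spanSingleton (nonZeroDivisors A) x * toFun I

namespace AFracStar

variable {A : Type*} [CommRing A]

theorem ext' {s t : AFracStar A} (h : s.toFun = t.toFun) : s = t := by
  cases s; cases t; cases h; rfl

instance : PartialOrder (AFracStar A) where
  le s t := ∀ I, s.toFun I ≤ t.toFun I
  le_refl _ _ := le_rfl
  le_trans _ _ _ hab hbc I := (hab I).trans (hbc I)
  le_antisymm _ _ h h' := ext' (funext fun I => le_antisymm (h I) (h' I))

end AFracStar

/-- Abstract star operations on `A`: fractional star operations closing `A`. -/
def AStar (A : Type*) [CommRing A] : Type _ := {s : AFracStar A // s.toFun 1 = 1}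

instance (A : Type*) [CommRing A] : PartialOrder (AStar A) :=
  inferInstanceAs (PartialOrder {s : AFracStar A // s.toFun 1 = 1})

end Paper

namespace Paper

variable (D : Type*) [CommRing D] [IsDomain D]

/-- `P` is a branching point of `Spec(D)`: the infimum (among the primes) of a
family of pairwise incomparable primes not containing `P`. -/
def IsBranchPoint (P : Ideal D) : Prop :=
  ∃ S : Set (Ideal D), (∀ Q ∈ S, Q.IsPrime) ∧
    (S.Pairwise fun Q₁ Q₂ => ¬Q₁ ≤ Q₂ ∧ ¬Q₂ ≤ Q₁) ∧ P ∉ S ∧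
    (∀ Q ∈ S, P ≤ Q) ∧ ∀ P' : Ideal D, P'.IsPrime → (∀ Q ∈ S, P' ≤ Q) → P' ≤ P

/-- The homeomorphically irreducible tree underlying `Spec(D)`: the zero ideal,
the maximal ideals and the branching points, ordered by inclusion. -/
def hiSpec : Set (Ideal D) :=
  {P | P.IsPrime ∧ (P = ⊥ ∨ P.IsMaximal ∨ IsBranchPoint D P)}

/-- `Q` is the element of `hiSpec D` directly below `P`. -/
def DirectlyBelow (Q P : Ideal D) : Prop :=
  Q ∈ hiSpec D ∧ P ∈ hiSpec D ∧ Q < P ∧ ∀ R ∈ hiSpec D, Q < R → ¬R < P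

/-- The localization of `D` at the prime ideal `P`, as an abstract ring. -/
abbrev locRing (P : Ideal D) (hP : P.IsPrime) : Type _ :=
  Localization (@Ideal.primeCompl D _ P hP)

/-- The valuation ring `Z(P) = D_P / Q·D_P`. -/
abbrev Zring (P Q : Ideal D) (hP : P.IsPrime) : Type _ :=
  locRing D P hP ⧸ Ideal.map (algebraMap D (locRing D P hP)) Q

/-- `ω(P) = |FStar(Z(P))|`, where `Q` is the element of `hiSpec D` directly
below `P`. -/
def omegaAt (P Q : Ideal D) (hP : P.IsPrime) : ℕ :=
  Nat.card (AFracStar (Zring D P Q hP))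

open Classical in
/-- `ε(P) = |Star(D_P)| ∈ {1,2}` for a (nonzero) prime `P`. -/
def epsilonOf (A : Ideal D) : ℕ :=
  if h : A.IsPrime then Nat.card (AStar (locRing D A h)) else 0

end Paper

namespace Paper

theorem mem_hiSpec_prime {D : Type*} [CommRing D] [IsDomain D] {P : Ideal D}
    (h : P ∈ hiSpec D) : P.IsPrime := h.1

theorem maximal_mem_hiSpec {D : Type*} [CommRing D] [IsDomain D] {M : Ideal D}
    (h : M.IsMaximal) : M ∈ hiSpec D := ⟨h.isPrime, Or.inr (Or.inl h)⟩

end Paper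

namespace Paper

section ValuationRing

open FractionalIdeal nonZeroDivisors

variable {V : Type*} [CommRing V] [IsDomain V] [ValuationRing V]

/-- Fractional ideals of `V` in its fraction field. -/
local notation "FI" V => FractionalIdeal (nonZeroDivisors V) (FractionRing V)

theorem mem_one_or_inv_mem_one (x : FractionRing V) :
    x ∈ (1 : FI V) ∨ x⁻¹ ∈ (1 : FI V) := by
  simp only [mem_one_iff]
  exact ValuationRing.isInteger_or_isInteger V x

theorem mul_mem_of_mem_one {I : FI V} {x y : FractionRing V} (hx : x ∈ (1 : FI V))
    (hy : y ∈ I) : x * y ∈ I := by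
  have := FractionalIdeal.mul_mem_mul hx hy
  rwa [one_mul] at this

theorem one_notMem_prime {A : Ideal V} (hA : A.IsPrime) : (1 : FractionRing V) ∉ (A : FI V) := by
  intro h
  obtain ⟨a, ha, e⟩ := (mem_coeIdeal _).mp h
  have : a = 1 := IsFractionRing.injective V (FractionRing V) (by rw [e, map_one])
  exact hA.ne_top ((Ideal.eq_top_iff_one A).mpr (this ▸ ha))

/-- For a nonzero prime `A` of a valuation ring `V`, the ring `(A : A)` is the
localization `V_A`, and `A` consists of its nonunits. -/
theorem mem_prime_iff {A : Ideal V} (hA : A.IsPrime) (h0 : A ≠ ⊥) (x : FractionRing V) :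
    x ∈ (A : FI V) ↔ x = 0 ∨ x⁻¹ ∉ (A / A : FI V) := by
  have h0' : (A : FI V) ≠ 0 := coeIdeal_ne_zero.mpr h0
  rw [mem_div_iff_of_ne_zero h0']
  constructor
  · intro hx
    by_contra! h
    have h1 := h.2 x hx
    rw [inv_mul_cancel₀ h.1] at h1
    exact one_notMem_prime hA h1
  · rintro (rfl | hx)
    · exact zero_mem _
    by_contra hxA
    apply hx
    intro y hy
    obtain ⟨a, ha, rfl⟩ := (mem_coeIdeal _).mp hy
    have hx0 : x ≠ 0 := by rintro rfl; exact hxA (zero_mem _)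
    rcases mem_one_or_inv_mem_one x with h | h
    · obtain ⟨b, rfl⟩ := (mem_one_iff _).mp h
      have hb : b ∉ A := fun hb => hxA ((mem_coeIdeal _).mpr ⟨b, hb, rfl⟩)
      obtain ⟨c, hc | hc⟩ := ValuationRing.cond a b
      · exact absurd (hc ▸ A.mul_mem_right c ha) hb
      · refine (mem_coeIdeal _).mpr ⟨c, (hA.mem_or_mem (hc ▸ ha)).resolve_left hb, ?_⟩
        rw [← hc, map_mul, inv_mul_cancel_left₀ hx0]
    · exact mul_mem_of_mem_one h hy

theorem mul_le_of_prime_div (A : Ideal V) : (A / A * A : FI V) ≤ A := by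
  by_cases h0 : (A : FI V) = 0
  · simp [h0]
  · exact (le_div_iff_mul_le h0).mp le_rfl

theorem one_le_prime_div {A : Ideal V} (h0 : A ≠ ⊥) : (1 : FI V) ≤ A / A :=
  (le_div_iff_mul_le (coeIdeal_ne_zero.mpr h0)).mpr (by rw [one_mul])

theorem prime_div_mul_self {A : Ideal V} (h0 : A ≠ ⊥) :
    (A / A * (A / A) : FI V) = A / A := by
  apply le_antisymm
  · rw [le_div_iff_mul_le (coeIdeal_ne_zero.mpr h0), mul_assoc]
    exact (mul_le_mul_right (mul_le_of_prime_div A) _).trans (mul_le_of_prime_div A)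
  · calc (A / A : FI V) = 1 * (A / A) := (one_mul _).symm
      _ ≤ _ := mul_le_mul_left (one_le_prime_div h0) _

/-- The nonunits of a fractional overring form a nonzero prime of `V`. -/
theorem exists_prime_of_overring (hV : ¬IsField V) {B : FI V} (h1 : 1 ≤ B)
    (hB : B * B ≤ B) : ∃ A : Ideal V, A.IsPrime ∧ A ≠ ⊥ ∧ (A / A : FI V) = B := by
  have hmul : ∀ {x y : FractionRing V}, x ∈ B → y ∈ B → x * y ∈ B := fun hx hy =>
    hB (FractionalIdeal.mul_mem_mul hx hy)
  have hint : ∀ a : V, algebraMap V (FractionRing V) a ∈ B := fun a =>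
    h1 ((mem_one_iff _).mpr ⟨a, rfl⟩)
  have hinj := IsFractionRing.injective V (FractionRing V)
  have hz : ∀ {a : V}, algebraMap V (FractionRing V) a = 0 → a = 0 := fun h =>
    hinj (by rw [h, map_zero])
  let A : Ideal V :=
    { carrier := {a | a = 0 ∨ (algebraMap V (FractionRing V) a)⁻¹ ∉ B}
      zero_mem' := Or.inl rfl
      smul_mem' := by
        rintro c a (rfl | ha)
        · exact Or.inl (smul_zero c)
        by_cases hc : c = 0
        · exact Or.inl (by rw [hc, zero_smul])
        refine Or.inr fun h => ha ?_
        have hc' : algebraMap V (FractionRing V) c ≠ 0 := fun h => hc (hz h)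
        have := hmul (hint c) h
        rwa [smul_eq_mul, map_mul, mul_inv, mul_inv_cancel_left₀ hc'] at this
      add_mem' := by
        have key : ∀ a c : V, (a = 0 ∨ (algebraMap V (FractionRing V) a)⁻¹ ∉ B) →
            a * c = 0 ∨ (algebraMap V (FractionRing V) (a * c))⁻¹ ∉ B := by
          rintro a c (rfl | ha)
          · exact Or.inl (zero_mul c)
          by_cases hc : c = 0
          · exact Or.inl (by rw [hc, mul_zero])
          refine Or.inr fun h => ha ?_
          have hc' : algebraMap V (FractionRing V) c ≠ 0 := fun h => hc (hz h)
          have := hmul (hint c) h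
          rwa [mul_comm a, map_mul, mul_inv, mul_inv_cancel_left₀ hc'] at this
        intro a b ha hb
        obtain ⟨c, rfl | rfl⟩ := ValuationRing.cond a b
        · have := key a (1 + c) ha
          rwa [mul_add, mul_one] at this
        · have := key b (c + 1) hb
          rwa [mul_add, mul_one] at this }
  have hmemA : ∀ a : V, a ∈ A ↔ a = 0 ∨ (algebraMap V (FractionRing V) a)⁻¹ ∉ B :=
    fun _ => Iff.rfl
  have hmem : ∀ x : FractionRing V, x ∈ (A : FI V) ↔ x = 0 ∨ x⁻¹ ∉ B := by
    intro x
    constructor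
    · intro hx
      obtain ⟨a, ha, rfl⟩ := (mem_coeIdeal _).mp hx
      exact ((hmemA a).mp ha).imp_left fun h => by rw [h, map_zero]
    · intro h
      have : x ∈ (1 : FI V) := by
        rcases h with rfl | h
        · exact zero_mem _
        · exact (mem_one_or_inv_mem_one x).resolve_right fun h' => h (h1 h')
      obtain ⟨a, rfl⟩ := (mem_one_iff _).mp this
      exact (mem_coeIdeal _).mpr ⟨a, h.imp_left hz, rfl⟩
  have hprime : A.IsPrime := by
    refine ⟨fun h => ?_, fun {a b} hab => ?_⟩
    · have : (1 : V) ∈ A := h ▸ trivial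
      simp only [hmemA, one_ne_zero, map_one, inv_one, false_or] at this
      exact this (h1 (one_mem_one _))
    · by_contra! h
      simp only [hmemA, not_or, not_not] at h hab
      rcases hab with h' | h'
      · exact (mul_ne_zero h.1.1 h.2.1) h'
      · rw [map_mul, mul_inv] at h'
        exact h' (hmul h.1.2 h.2.2)
  have hne : A ≠ ⊥ := by
    intro hbot
    have hall : ∀ x : FractionRing V, x ∈ B := by
      intro x
      by_cases hx : x = 0
      · exact hx ▸ zero_mem _
      by_contra h
      have : x⁻¹ ∈ (A : FI V) := (hmem _).mpr (Or.inr (by rwa [inv_inv]))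
      rw [hbot, coeIdeal_bot, mem_zero_iff] at this
      exact hx (inv_eq_zero.mp this)
    obtain ⟨d, hd, hdB⟩ := B.isFractional
    have hd0 : algebraMap V (FractionRing V) d ≠ 0 := fun h => nonZeroDivisors.ne_zero hd (hz h)
    refine hV ⟨⟨0, 1, zero_ne_one⟩, mul_comm, fun {a} ha => ?_⟩
    have ha0 : algebraMap V (FractionRing V) a ≠ 0 := fun h => ha (hz h)
    obtain ⟨b, hb⟩ := hdB _ (hall ((algebraMap V (FractionRing V) d)⁻¹ *
      (algebraMap V (FractionRing V) a)⁻¹))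
    refine ⟨b, hinj ?_⟩
    rw [map_mul, hb, Algebra.smul_def, mul_inv_cancel_left₀ hd0, mul_inv_cancel₀ ha0, map_one]
  refine ⟨A, hprime, hne, ?_⟩
  ext x
  rw [mem_div_iff_of_ne_zero (coeIdeal_ne_zero.mpr hne)]
  constructor
  · intro h
    by_cases hx : x = 0
    · exact hx ▸ zero_mem _
    by_contra hxB
    have := h _ ((hmem x⁻¹).mpr (Or.inr (by rwa [inv_inv])))
    rw [mul_inv_cancel₀ hx, hmem, inv_one] at this
    exact this.elim one_ne_zero fun h => h (h1 (one_mem_one _))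
  · intro hx y hy
    rw [hmem] at hy ⊢
    by_cases hx0 : x = 0
    · exact Or.inl (by rw [hx0, zero_mul])
    refine hy.imp (fun h => by rw [h, mul_zero]) fun h h' => h ?_
    have := hmul hx h'
    rwa [mul_inv, mul_inv_cancel_left₀ hx0] at this

/-- If `x` lies outside the `V_A`-module `I V_A` then `I V_A ⊆ x A`. -/
theorem mul_prime_div_le {A : Ideal V} (hA : A.IsPrime) (h0 : A ≠ ⊥) {I : FI V}
    {x : FractionRing V} (hx : x ∉ I * (A / A : FI V)) :
    I * (A / A : FI V) ≤ spanSingleton _ x * (A : FI V) := by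
  have hx0 : x ≠ 0 := by rintro rfl; exact hx (zero_mem _)
  intro y hy
  refine mem_singleton_mul.mpr ⟨x⁻¹ * y, ?_, (mul_inv_cancel_left₀ hx0 y).symm⟩
  rw [mem_prime_iff hA h0]
  by_cases hy0 : y = 0
  · exact Or.inl (by rw [hy0, mul_zero])
  refine Or.inr fun h => hx ?_
  have := FractionalIdeal.mul_mem_mul hy h
  rwa [mul_assoc I, prime_div_mul_self h0, mul_inv, inv_inv, mul_left_comm,
    mul_inv_cancel₀ hy0, mul_one] at this

theorem le_spanSingleton_of_notMem {I : FI V} {x : FractionRing V} (hx : x ∉ I) :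
    I ≤ spanSingleton _ x := by
  have hx0 : x ≠ 0 := by rintro rfl; exact hx (zero_mem _)
  intro y hy
  rcases mem_one_or_inv_mem_one (x⁻¹ * y) with h | h
  · obtain ⟨a, ha⟩ := (mem_one_iff _).mp h
    refine (mem_spanSingleton _).mpr ⟨a, ?_⟩
    rw [Algebra.smul_def, ha, mul_right_comm, inv_mul_cancel₀ hx0, one_mul]
  · by_cases hy0 : y = 0
    · exact hy0 ▸ zero_mem _
    have := mul_mem_of_mem_one h hy
    rw [mul_inv, inv_inv, mul_assoc, inv_mul_cancel₀ hy0, mul_one] at this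
    exact absurd this hx

theorem div_mono {I J A : FI V} (h : I ≤ J) : I / A ≤ J / A := by
  by_cases h0 : A = 0
  · simp [h0, FractionalIdeal.div_zero]
  · exact (le_div_iff_mul_le h0).mpr (((le_div_iff_mul_le h0).mp le_rfl).trans h)

theorem spanSingleton_mul_div {x : FractionRing V} (hx : x ≠ 0) (I A : FI V) :
    spanSingleton _ x * I / A = spanSingleton _ x * (I / A) := by
  by_cases h0 : A = 0
  · simp [h0, FractionalIdeal.div_zero]
  ext y
  simp only [mem_singleton_mul, mem_div_iff_of_ne_zero h0]
  constructor
  · intro h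
    refine ⟨x⁻¹ * y, fun z hz => ?_, (mul_inv_cancel_left₀ hx y).symm⟩
    obtain ⟨w, hw, e⟩ := h z hz
    rwa [mul_assoc, e, inv_mul_cancel_left₀ hx]
  · rintro ⟨w, hw, rfl⟩ z hz
    exact ⟨w * z, hw z hz, mul_assoc _ _ _⟩

/-- The extension `I ↦ I V_A` as a fractional star operation. -/
def extStar (A : Ideal V) (h0 : A ≠ ⊥) : AFracStar V where
  toFun I := I * (A / A : FI V)
  le_star' I := by
    calc I = I * 1 := (mul_one _).symm
      _ ≤ _ := mul_le_mul_right (one_le_prime_div h0) _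
  mono' _ _ h := mul_le_mul_left h _
  idem' I := by rw [mul_assoc, prime_div_mul_self h0]
  smul' _ _ _ := mul_assoc _ _ _

/-- For an idempotent ideal `A`, the fractional star operation `I ↦ (I : A)`;
if `A` is prime, it is the divisorial closure over `V_A`. -/
def colonStar (A : Ideal V) (h0 : A ≠ ⊥) (hi : A * A = A) : AFracStar V where
  toFun I := I / (A : FI V)
  le_star' I := by
    rw [le_div_iff_mul_le (coeIdeal_ne_zero.mpr h0)]
    calc I * A ≤ I * 1 := mul_le_mul_right coeIdeal_le_one _
      _ = I := mul_one _
  mono' _ _ h := div_mono h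
  idem' I := by
    have hA : (A : FI V) ≠ 0 := coeIdeal_ne_zero.mpr h0
    apply le_antisymm
    · rw [le_div_iff_mul_le hA]
      have h1 : I / (A : FI V) / A * A ≤ I / (A : FI V) := (le_div_iff_mul_le hA).mp le_rfl
      have h2 := (le_div_iff_mul_le hA).mp h1
      rwa [mul_assoc, ← coeIdeal_mul, hi] at h2
    · rw [le_div_iff_mul_le hA]
      calc I / (A : FI V) * A ≤ I / (A : FI V) * 1 := mul_le_mul_right coeIdeal_le_one _
        _ = _ := mul_one _
  smul' x hx I := spanSingleton_mul_div hx I A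

theorem extStar_one (A : Ideal V) (h0 : A ≠ ⊥) :
    (extStar A h0).toFun 1 = (A / A : FI V) := one_mul _

theorem colonStar_one (A : Ideal V) (h0 : A ≠ ⊥) (hi : A * A = A) :
    (colonStar A h0 hi).toFun 1 = (A / A : FI V) := by
  have hA : (A : FI V) ≠ 0 := coeIdeal_ne_zero.mpr h0
  apply le_antisymm
  · rw [le_div_iff_mul_le hA]
    have h1 : (1 / A : FI V) * A ≤ 1 := (le_div_iff_mul_le hA).mp le_rfl
    calc (1 / A : FI V) * A = (1 / A : FI V) * A * A := by
          rw [mul_assoc, ← coeIdeal_mul, hi]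
      _ ≤ 1 * A := mul_le_mul_left h1 _
      _ = A := one_mul _
  · exact div_mono coeIdeal_le_one

theorem mul_star_one_le (s : AFracStar V) (I : FI V) :
    I * s.toFun 1 ≤ s.toFun I := by
  rw [FractionalIdeal.mul_le]
  intro x hx y hy
  by_cases hx0 : x = 0
  · rw [hx0, zero_mul]; exact zero_mem _
  have h1 : spanSingleton _ x * s.toFun 1 ≤ s.toFun I := by
    rw [← s.smul' x hx0, mul_one]
    exact s.mono' (spanSingleton_le_iff_mem.mpr hx)
  exact h1 (mem_singleton_mul.mpr ⟨y, hy, rfl⟩)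

theorem star_mem_smul (s : AFracStar V) {x y : FractionRing V} (hx : x ≠ 0) {I : FI V}
    (hy : y ∈ s.toFun (spanSingleton _ x * I)) : x⁻¹ * y ∈ s.toFun I := by
  rw [s.smul' x hx] at hy
  obtain ⟨z, hz, rfl⟩ := mem_singleton_mul.mp hy
  rwa [inv_mul_cancel_left₀ hx]

/-- Every fractional star operation on a valuation ring that is not a field has the
form `I ↦ I V_A`, or `I ↦ (I : A)` with `A` idempotent. -/
theorem eq_extStar_or_colonStar (hV : ¬IsField V) (s : AFracStar V) :
    ∃ (A : Ideal V) (_ : A.IsPrime) (h0 : A ≠ ⊥),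
      s = extStar A h0 ∨ ∃ hi : A * A = A, s = colonStar A h0 hi := by
  have hB : s.toFun 1 * s.toFun 1 ≤ s.toFun 1 := by
    have := mul_star_one_le s (s.toFun 1)
    rwa [s.idem'] at this
  obtain ⟨A, hA, h0, hAB⟩ := exists_prime_of_overring hV (s.le_star' 1) hB
  refine ⟨A, hA, h0, ?_⟩
  have hA0 : (A : FI V) ≠ 0 := coeIdeal_ne_zero.mpr h0
  by_cases hs : ∀ I, s.toFun I = I * (A / A : FI V)
  · exact Or.inl (AFracStar.ext' (funext hs))
  right
  push Not at hs
  obtain ⟨I, hI⟩ := hs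
  have hle : I * (A / A : FI V) ≤ s.toFun I := hAB ▸ mul_star_one_le s I
  obtain ⟨x, hxs, hxI⟩ : ∃ x ∈ s.toFun I, x ∉ I * (A / A : FI V) := by
    by_contra! h
    exact hI (le_antisymm h hle)
  have hx0 : x ≠ 0 := by rintro rfl; exact hxI (zero_mem _)
  have hIx : I ≤ spanSingleton _ x * (A : FI V) := by
    refine le_trans ?_ (mul_prime_div_le hA h0 hxI)
    calc I = I * 1 := (mul_one _).symm
      _ ≤ _ := mul_le_mul_right (one_le_prime_div h0) _
  have h1A : (1 : FractionRing V) ∈ s.toFun A := by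
    have := star_mem_smul s hx0 (s.mono' hIx hxs)
    rwa [inv_mul_cancel₀ hx0] at this
  have hBA : (A : FI V) * (A / A : FI V) ≤ A := by
    rw [mul_comm]; exact mul_le_of_prime_div A
  have hi : A * A = A := by
    by_contra hne
    have hlt : ¬ (A : FI V) ≤ A * A := fun h => hne <| le_antisymm Ideal.mul_le_left <| by
      rwa [← coeIdeal_mul, coeIdeal_le_coeIdeal] at h
    obtain ⟨a, haA, haAA⟩ := SetLike.not_le_iff_exists.mp hlt
    have ha0 : a ≠ 0 := by rintro rfl; exact haAA (zero_mem _)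
    have hAa : (A : FI V) ≤ spanSingleton _ a * s.toFun 1 := by
      intro y hy
      refine mem_singleton_mul.mpr ⟨a⁻¹ * y, ?_, (mul_inv_cancel_left₀ ha0 y).symm⟩
      by_contra hn
      have hm : (a⁻¹ * y)⁻¹ ∈ (A : FI V) := by
        rw [mem_prime_iff hA h0, inv_inv, hAB]
        exact Or.inr hn
      by_cases hy0 : y = 0
      · rw [hy0, mul_zero] at hn; exact hn (zero_mem _)
      have := FractionalIdeal.mul_mem_mul hy hm
      rw [mul_inv, inv_inv, mul_left_comm, mul_inv_cancel₀ hy0, mul_one] at this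
      exact haAA this
    have h2 : s.toFun A ≤ spanSingleton _ a * s.toFun 1 := by
      have := s.mono' hAa
      rwa [s.smul' a ha0, s.idem'] at this
    have h3 : spanSingleton _ a * s.toFun 1 ≤ (A : FI V) := by
      rw [← hAB]
      exact (mul_le_mul_left (spanSingleton_le_iff_mem.mpr haA) _).trans hBA
    exact one_notMem_prime hA (h3 (h2 h1A))
  refine ⟨hi, AFracStar.ext' (funext fun J => le_antisymm ?_ ?_)⟩
  · change s.toFun J ≤ J / (A : FI V)
    intro y hy
    rw [mem_div_iff_of_ne_zero hA0]
    intro a ha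
    by_contra hn
    have hya0 : y * a ≠ 0 := fun h => hn (h ▸ zero_mem _)
    have hJ := le_spanSingleton_of_notMem hn
    rw [← mul_one (spanSingleton _ (y * a))] at hJ
    have h1 := star_mem_smul s hya0 (s.mono' hJ hy)
    rw [← hAB] at h1
    have h2 := FractionalIdeal.mul_mem_mul ha h1
    rw [mul_inv, mul_right_comm, inv_mul_cancel₀ (left_ne_zero_of_mul hya0), one_mul,
      mul_inv_cancel₀ (right_ne_zero_of_mul hya0)] at h2
    exact one_notMem_prime hA (hBA h2)
  · change J / (A : FI V) ≤ s.toFun J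
    intro y hy
    by_cases hy0 : y = 0
    · exact hy0 ▸ zero_mem _
    rw [mem_div_iff_of_ne_zero hA0] at hy
    have hle : spanSingleton _ y * (A : FI V) ≤ J := by
      intro z hz
      obtain ⟨w, hw, rfl⟩ := mem_singleton_mul.mp hz
      exact hy w hw
    have := s.mono' hle
    rw [s.smul' y hy0] at this
    exact this (mem_singleton_mul.mpr ⟨1, h1A, (mul_one y).symm⟩)

theorem prime_div_injective {A A' : Ideal V} (hA : A.IsPrime) (h0 : A ≠ ⊥) (hA' : A'.IsPrime)
    (h0' : A' ≠ ⊥) (h : (A / A : FI V) = A' / A') : A = A' := by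
  apply coeIdeal_inj (K := FractionRing V).mp
  ext x
  rw [mem_prime_iff hA h0, mem_prime_iff hA' h0', h]

theorem extStar_ne_colonStar {A : Ideal V} (hA : A.IsPrime) (h0 : A ≠ ⊥) (hi : A * A = A) :
    extStar A h0 ≠ colonStar A h0 hi := by
  intro h
  have h1 : (A : FI V) * (A / A : FI V) = A / A :=
    congrFun (congrArg AFracStar.toFun h) (A : FI V)
  apply one_notMem_prime hA
  apply mul_le_of_prime_div A
  rw [mul_comm, h1]
  exact one_le_prime_div h0 (one_mem_one _)

variable (V) in
/-- The fractional star operations on a valuation ring that is not a field correspond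
to its nonzero primes together with a second copy of its nonzero idempotent primes. -/
def starOfPrime :
    {A : Ideal V // A.IsPrime ∧ A ≠ ⊥} ⊕ {A : Ideal V // A.IsPrime ∧ A ≠ ⊥ ∧ A * A = A} →
      AFracStar V
  | .inl A => extStar A.1 A.2.2
  | .inr A => colonStar A.1 A.2.2.1 A.2.2.2

theorem starOfPrime_bijective (hV : ¬IsField V) : Function.Bijective (starOfPrime V) := by
  constructor
  · rintro (⟨A, hA, h0⟩ | ⟨A, hA, h0, hi⟩) (⟨A', hA', h0'⟩ | ⟨A', hA', h0', hi'⟩) h <;>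
      simp only [starOfPrime] at h <;>
      have h1 := congrFun (congrArg AFracStar.toFun h) 1 <;>
      simp only [extStar_one, colonStar_one] at h1 <;>
      obtain rfl := prime_div_injective hA h0 hA' h0' h1
    · rfl
    · exact absurd h (extStar_ne_colonStar hA h0 hi')
    · exact absurd h.symm (extStar_ne_colonStar hA h0 hi)
    · rfl
  · intro s
    obtain ⟨A, hA, h0, rfl | ⟨hi, rfl⟩⟩ := eq_extStar_or_colonStar hV s
    · exact ⟨.inl ⟨A, hA, h0⟩, rfl⟩
    · exact ⟨.inr ⟨A, hA, h0, hi⟩, rfl⟩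

theorem prime_div_eq_one_iff {A : Ideal V} (hA : A.IsPrime) (h0 : A ≠ ⊥) :
    (A / A : FI V) = 1 ↔ A = IsLocalRing.maximalIdeal V := by
  constructor
  · intro h
    ext a
    have hmem : a ∈ A ↔ algebraMap V (FractionRing V) a ∈ (A : FI V) := by
      rw [mem_coeIdeal]
      exact ⟨fun ha => ⟨a, ha, rfl⟩, fun ⟨b, hb, e⟩ =>
        IsFractionRing.injective V (FractionRing V) e ▸ hb⟩
    rw [hmem, mem_prime_iff hA h0, h, IsLocalRing.mem_maximalIdeal, mem_nonunits_iff]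
    constructor
    · rintro h1 h2
      obtain ⟨b, hb⟩ := h2.exists_right_inv
      have hb' : algebraMap V (FractionRing V) a * algebraMap V (FractionRing V) b = 1 := by
        rw [← map_mul, hb, map_one]
      rcases h1 with h1 | h1
      · rw [h1, zero_mul] at hb'
        exact zero_ne_one hb'
      · exact h1 ((mem_one_iff _).mpr ⟨b, eq_inv_of_mul_eq_one_right hb'⟩)
    · intro h1
      by_contra! h2
      obtain ⟨b, hb⟩ := (mem_one_iff _).mp h2.2
      refine h1 (IsUnit.of_mul_eq_one b (IsFractionRing.injective V (FractionRing V) ?_))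
      rw [map_mul, hb, mul_inv_cancel₀ h2.1, map_one]
  · intro h
    refine le_antisymm (fun x hx => ?_) (one_le_prime_div h0)
    by_contra hx1
    obtain ⟨a, ha⟩ := (mem_one_iff _).mp ((mem_one_or_inv_mem_one x).resolve_left hx1)
    have hx0 : x ≠ 0 := by rintro rfl; exact hx1 (zero_mem _)
    have haA : a ∈ A := by
      rw [h, IsLocalRing.mem_maximalIdeal, mem_nonunits_iff]
      intro hu
      obtain ⟨b, hb⟩ := hu.exists_right_inv
      refine hx1 ((mem_one_iff _).mpr ⟨b, ?_⟩)
      have hb' : algebraMap V (FractionRing V) a * algebraMap V (FractionRing V) b = 1 := by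
        rw [← map_mul, hb, map_one]
      rw [ha] at hb'
      rw [← mul_inv_cancel_left₀ hx0 (algebraMap V (FractionRing V) b), hb', mul_one]
    have h1 := (mem_div_iff_of_ne_zero (coeIdeal_ne_zero.mpr h0)).mp hx _
      (mem_coeIdeal_of_mem _ haA)
    rw [ha, mul_inv_cancel₀ hx0] at h1
    exact one_notMem_prime hA h1

theorem card_fracStar (hV : ¬IsField V) (hfin : {A : Ideal V | A.IsPrime ∧ A ≠ ⊥}.Finite) :
    Nat.card (AFracStar V) = {A : Ideal V | A.IsPrime ∧ A ≠ ⊥}.ncard +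
      {A : Ideal V | A.IsPrime ∧ A ≠ ⊥ ∧ A * A = A}.ncard := by
  have : Finite {A : Ideal V // A.IsPrime ∧ A ≠ ⊥} := hfin.to_subtype
  have : Finite {A : Ideal V // A.IsPrime ∧ A ≠ ⊥ ∧ A * A = A} :=
    (hfin.subset fun A hA => ⟨hA.1, hA.2.1⟩ :
      {A : Ideal V | A.IsPrime ∧ A ≠ ⊥ ∧ A * A = A}.Finite).to_subtype
  rw [← Nat.card_congr (Equiv.ofBijective _ (starOfPrime_bijective hV))]
  exact Nat.card_sum

open Classical in
theorem card_star (hV : ¬IsField V) :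
    Nat.card (AStar V) = 1 +
      if IsLocalRing.maximalIdeal V * IsLocalRing.maximalIdeal V = IsLocalRing.maximalIdeal V
        then 1 else 0 := by
  have hM0 : IsLocalRing.maximalIdeal V ≠ ⊥ := fun h =>
    hV (IsLocalRing.isField_iff_maximalIdeal_eq.mpr h)
  have hMp : (IsLocalRing.maximalIdeal V).IsPrime := inferInstance
  have key : ∀ t, (starOfPrime V t).toFun 1 = 1 ↔
      Sum.elim (fun A => A.1) (fun A => A.1) t = IsLocalRing.maximalIdeal V := by
    rintro (⟨A, hA, h0⟩ | ⟨A, hA, h0, hi⟩)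
    · change (extStar A h0).toFun 1 = 1 ↔ _
      rw [extStar_one]
      exact prime_div_eq_one_iff hA h0
    · change (colonStar A h0 hi).toFun 1 = 1 ↔ _
      rw [colonStar_one]
      exact prime_div_eq_one_iff hA h0
  have e : AStar V ≃ {A : {A : Ideal V // A.IsPrime ∧ A ≠ ⊥} // A.1 = IsLocalRing.maximalIdeal V} ⊕
      {A : {A : Ideal V // A.IsPrime ∧ A ≠ ⊥ ∧ A * A = A} //
        A.1 = IsLocalRing.maximalIdeal V} :=
    ((Equiv.ofBijective _ (starOfPrime_bijective hV)).subtypeEquiv fun t => (key t).symm).symm.trans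
      Equiv.subtypeSum
  have : Unique {A : {A : Ideal V // A.IsPrime ∧ A ≠ ⊥} // A.1 = IsLocalRing.maximalIdeal V} :=
    ⟨⟨⟨⟨_, hMp, hM0⟩, rfl⟩⟩, fun A => Subtype.ext (Subtype.ext A.2)⟩
  rw [Nat.card_congr e]
  split_ifs with hi
  · have : Unique {A : {A : Ideal V // A.IsPrime ∧ A ≠ ⊥ ∧ A * A = A} //
        A.1 = IsLocalRing.maximalIdeal V} :=
      ⟨⟨⟨⟨_, hMp, hM0, hi⟩, rfl⟩⟩, fun A => Subtype.ext (Subtype.ext A.2)⟩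
    rw [Nat.card_sum, Nat.card_unique, Nat.card_unique]
  · have : IsEmpty {A : {A : Ideal V // A.IsPrime ∧ A ≠ ⊥ ∧ A * A = A} //
        A.1 = IsLocalRing.maximalIdeal V} := ⟨fun A => hi (A.2 ▸ A.1.2.2.2)⟩
    rw [Nat.card_sum, Nat.card_unique, Nat.card_of_isEmpty]

end ValuationRing

end Paper
namespace Paper

section Prufer

variable {D : Type*} [CommRing D] [IsDomain D]

theorem IsPrufer.dvd_total {K : Type*} [Field K] [Algebra D K] [IsFractionRing D K]
    (h : IsPrufer D K) {P : Ideal D} (hP : P.IsPrime) (x y : D) :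
    ∃ a s, s ∉ P ∧ (s * y = a * x ∨ s * x = a * y) := by
  have key : ∀ x y : D, ∀ z : locAt D K P hP,
      algebraMap D (locAt D K P hP) x * z = algebraMap D (locAt D K P hP) y →
        ∃ a s, s ∉ P ∧ s * y = a * x := by
    intro x y z hz
    obtain ⟨a, s, hs, e⟩ := z.2
    refine ⟨a, s, hs, IsFractionRing.injective D K ?_⟩
    have hz' : algebraMap D K x * z.1 = algebraMap D K y := congrArg Subtype.val hz
    rw [map_mul, map_mul, ← hz', e, mul_left_comm]
    rw [mul_comm (algebraMap D K s), IsLocalization.mk'_spec, mul_comm]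
  obtain ⟨z, hz | hz⟩ := h P hP (algebraMap D _ x) (algebraMap D _ y)
  · obtain ⟨a, s, hs, e⟩ := key x y z hz
    exact ⟨a, s, hs, Or.inl e⟩
  · obtain ⟨a, s, hs, e⟩ := key y x z hz
    exact ⟨a, s, hs, Or.inr e⟩

/-- Divisibility is total locally at every prime. -/
def LocallyTotal (D : Type*) [CommRing D] : Prop :=
  ∀ P : Ideal D, P.IsPrime → ∀ x y : D, ∃ a s, s ∉ P ∧ (s * y = a * x ∨ s * x = a * y)

theorem LocallyTotal.preValuationRing_locRing (h : LocallyTotal D) {P : Ideal D}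
    (hP : P.IsPrime) : PreValuationRing (locRing D P hP) := by
  have key : ∀ (x y a s : D) (u v : P.primeCompl), s ∉ P → s * y = a * x →
      IsLocalization.mk' (locRing D P hP) x u ∣ IsLocalization.mk' (locRing D P hP) y v := by
    intro x y a s u v hs e
    refine ⟨IsLocalization.mk' _ (a * u) (v * ⟨s, hs⟩), ?_⟩
    rw [← IsLocalization.mk'_mul, IsLocalization.mk'_eq_iff_eq]
    congr 1
    simp only [Submonoid.coe_mul]
    linear_combination (u * v : D) * e
  rw [PreValuationRing.iff_dvd_total]
  refine ⟨fun z w => ?_⟩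
  obtain ⟨x, u, rfl⟩ := IsLocalization.exists_mk'_eq P.primeCompl z
  obtain ⟨y, v, rfl⟩ := IsLocalization.exists_mk'_eq P.primeCompl w
  obtain ⟨a, s, hs, e | e⟩ := h P hP x y
  · exact Or.inl (key x y a s u v hs e)
  · exact Or.inr (key y x a s v u hs e)

theorem LocallyTotal.le_or_le (h : LocallyTotal D) {P A B : Ideal D} (hP : P.IsPrime)
    (hA : A.IsPrime) (hB : B.IsPrime) (hAP : A ≤ P) (hBP : B ≤ P) : A ≤ B ∨ B ≤ A := by
  by_contra! hn
  obtain ⟨x, hxA, hxB⟩ := SetLike.not_le_iff_exists.mp hn.1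
  obtain ⟨y, hyB, hyA⟩ := SetLike.not_le_iff_exists.mp hn.2
  obtain ⟨a, s, hs, e | e⟩ := h P hP x y
  · exact (hA.mem_or_mem (e ▸ A.mul_mem_left a hxA)).elim (fun h => hs (hAP h)) hyA
  · exact (hB.mem_or_mem (e ▸ B.mul_mem_left a hyB)).elim (fun h => hs (hBP h)) hxB

theorem LocallyTotal.finite_primes_le (h : LocallyTotal D) (hdim : ringKrullDim D < ⊤)
    {P : Ideal D} (hP : P.IsPrime) : {A : Ideal D | A.IsPrime ∧ A ≤ P}.Finite := by
  have : FiniteRingKrullDim D :=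
    Order.finiteDimensionalOrder_iff_krullDim_ne_bot_and_top.mpr
      ⟨Order.krullDim_ne_bot_iff.mpr inferInstance, hdim.ne⟩
  obtain ⟨n, hn⟩ := ENat.ne_top_iff_exists.mp (P.height_ne_top hP.ne_top)
  have hinj : Set.InjOn Ideal.height {A : Ideal D | A.IsPrime ∧ A ≤ P} := by
    rintro A ⟨hA, hAP⟩ B ⟨hB, hBP⟩ hAB
    by_contra hne
    rcases h.le_or_le hP hA hB hAP hBP with hle | hle
    · exact hAB.not_lt (Ideal.height_strict_mono_of_isPrime_of_isPrime (hle.lt_of_ne hne))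
    · exact hAB.not_gt (Ideal.height_strict_mono_of_isPrime_of_isPrime
        (hle.lt_of_ne (Ne.symm hne)))
  refine Set.Finite.of_finite_image (Set.Finite.subset
    ((Set.finite_Iic n).image (Nat.cast : ℕ → ℕ∞)) ?_) hinj
  rintro _ ⟨A, ⟨-, hAP⟩, rfl⟩
  have hle : A.height ≤ n := hn ▸ Ideal.height_mono hAP
  obtain ⟨m, hm⟩ := ENat.ne_top_iff_exists.mp (ne_top_of_le_ne_top (ENat.natCast_ne_top n) hle)
  exact ⟨m, by rw [← hm] at hle; exact_mod_cast hle, hm⟩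

theorem mem_of_forall_maximal {I : Ideal D} {x : D}
    (h : ∀ M : Ideal D, M.IsMaximal → ∃ t ∉ M, t * x ∈ I) : x ∈ I := by
  by_contra hx
  have hne : I.colon {x} ≠ ⊤ := by
    rw [Ne, Ideal.eq_top_iff_one, Submodule.mem_colon_singleton]
    simpa using hx
  obtain ⟨M, hM, hle⟩ := Ideal.exists_le_maximal _ hne
  obtain ⟨t, ht, htx⟩ := h M hM
  exact ht (hle (Submodule.mem_colon_singleton.mpr htx))

/-- An element of a prime `A` that some `s ∉ A` multiplies into `A²` lies in `A²`. -/
theorem LocallyTotal.mem_sq_of_mul_mem (h : LocallyTotal D) {A : Ideal D} (hA : A.IsPrime)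
    {a s : D} (ha : a ∈ A) (hs : s ∉ A) (hsa : s * a ∈ A * A) : a ∈ A * A := by
  have hs0 : s ≠ 0 := by rintro rfl; exact hs A.zero_mem
  refine mem_of_forall_maximal fun M hM => ?_
  by_cases hAM : A ≤ M
  swap
  · obtain ⟨t, htA, htM⟩ := SetLike.not_le_iff_exists.mp hAM
    exact ⟨t, htM, Ideal.mul_mem_mul htA ha⟩
  have key : ∀ x ∈ A * A, ∃ t ∉ M, ∃ y ∈ A * A, t * x = s * y := by
    intro x hx
    induction hx using Submodule.mul_induction_on' with
    | mem_mul_mem b hb c hc =>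
      obtain ⟨r, t, ht, e | e⟩ := h M hM.isPrime s b
      · have hr : r ∈ A := by
          have : r * s ∈ A := e ▸ A.mul_mem_left t hb
          exact (hA.mem_or_mem this).resolve_right hs
        exact ⟨t, ht, r * c, Ideal.mul_mem_mul hr hc, by linear_combination c * e⟩
      · have : t * s ∈ A := e ▸ A.mul_mem_left r hb
        exact absurd this fun h => (hA.mem_or_mem h).elim (fun h => ht (hAM h)) hs
    | add x _ y _ hx hy =>
      obtain ⟨t, ht, x', hx', ex⟩ := hx
      obtain ⟨u, hu, y', hy', ey⟩ := hy
      refine ⟨t * u, fun h => (hM.isPrime.mem_or_mem h).elim ht hu, u * x' + t * y',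
        Ideal.add_mem _ (Ideal.mul_mem_left _ _ hx') (Ideal.mul_mem_left _ _ hy'), ?_⟩
      linear_combination u * ex + t * ey
  obtain ⟨t, ht, y, hy, e⟩ := key _ hsa
  refine ⟨t, ht, ?_⟩
  have : t * a = y := mul_left_cancel₀ hs0 (by linear_combination e)
  exact this ▸ hy

theorem LocallyTotal.le_sq_of_lt (h : LocallyTotal D) {A Q : Ideal D} (hQ : Q.IsPrime)
    (hQA : Q < A) : Q ≤ A * A := by
  obtain ⟨c, hcA, hcQ⟩ := SetLike.not_le_iff_exists.mp hQA.not_ge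
  intro q hq
  refine mem_of_forall_maximal fun M hM => ?_
  by_cases hAM : A ≤ M
  swap
  · obtain ⟨t, htA, htM⟩ := SetLike.not_le_iff_exists.mp hAM
    exact ⟨t, htM, Ideal.mul_mem_mul htA (hQA.le hq)⟩
  obtain ⟨r, t, ht, e | e⟩ := h M hM.isPrime (c * c) q
  · exact ⟨t, ht, e ▸ Ideal.mul_mem_left _ _ (Ideal.mul_mem_mul hcA hcA)⟩
  · have : t * (c * c) ∈ Q := e ▸ Q.mul_mem_left r hq
    rcases hQ.mem_or_mem this with h | h
    · exact absurd (hAM (hQA.le h)) ht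
    · exact absurd ((hQ.mem_or_mem h).elim id id) hcQ

theorem isDomain_locRing {P : Ideal D} (hP : P.IsPrime) : IsDomain (locRing D P hP) :=
  IsLocalization.isDomain_localization P.primeCompl_le_nonZeroDivisors

theorem LocallyTotal.maximalIdeal_sq_eq_iff (h : LocallyTotal D) {A : Ideal D} (hA : A.IsPrime) :
    IsLocalRing.maximalIdeal (locRing D A hA) * IsLocalRing.maximalIdeal (locRing D A hA) =
      IsLocalRing.maximalIdeal (locRing D A hA) ↔ A * A = A := by
  rw [← IsLocalization.AtPrime.map_eq_maximalIdeal A (locRing D A hA), ← Ideal.map_mul]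
  refine ⟨fun hm => le_antisymm Ideal.mul_le_left fun a ha => ?_, fun hi => by rw [hi]⟩
  have h1 := Ideal.mem_map_of_mem (algebraMap D (locRing D A hA)) ha
  rw [← hm, IsLocalization.algebraMap_mem_map_algebraMap_iff A.primeCompl] at h1
  obtain ⟨s, hs, hsa⟩ := h1
  exact h.mem_sq_of_mul_mem hA ha hs hsa

open Classical in
theorem LocallyTotal.epsilonOf_eq (h : LocallyTotal D) {A : Ideal D} (hA : A.IsPrime)
    (h0 : A ≠ ⊥) : epsilonOf D A = 1 + if A * A = A then 1 else 0 := by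
  have := isDomain_locRing hA
  have := h.preValuationRing_locRing hA
  have : ValuationRing (locRing D A hA) := ⟨⟩
  have hV : ¬IsField (locRing D A hA) := by
    rw [IsLocalRing.isField_iff_maximalIdeal_eq,
      ← IsLocalization.AtPrime.map_eq_maximalIdeal A (locRing D A hA),
      Ideal.map_eq_bot_iff_of_injective
        (IsLocalization.injective _ A.primeCompl_le_nonZeroDivisors)]
    exact h0
  rw [epsilonOf, dif_pos hA, card_star hV]
  simp only [h.maximalIdeal_sq_eq_iff hA]

/-- The canonical map `D → Z(P)`. -/
def toZring (P Q : Ideal D) (hP : P.IsPrime) : D →+* Zring D P Q hP :=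
  (Ideal.Quotient.mk _).comp (algebraMap D (locRing D P hP))

section Zring

variable {P Q : Ideal D} {hP : P.IsPrime}

theorem map_toZring (I : Ideal D) : I.map (toZring P Q hP) =
    (I.map (algebraMap D (locRing D P hP))).map (Ideal.Quotient.mk _) :=
  (Ideal.map_map _ _).symm

theorem map_comap_toZring (B : Ideal (Zring D P Q hP)) :
    (B.comap (toZring P Q hP)).map (toZring P Q hP) = B := by
  have h1 := IsLocalization.map_under P.primeCompl (locRing D P hP)
    (B.comap (Ideal.Quotient.mk _))
  rw [map_toZring]
  refine Eq.trans (congrArg _ h1) ?_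
  exact Ideal.map_comap_of_surjective _ Ideal.Quotient.mk_surjective B

theorem toZring_mem_map_iff {I : Ideal D} {a : D} :
    toZring P Q hP a ∈ I.map (toZring P Q hP) ↔ ∃ s ∉ P, s * a ∈ I ⊔ Q := by
  rw [map_toZring, toZring, RingHom.comp_apply, Ideal.mem_quotient_iff_mem_sup, ← Ideal.map_sup,
    IsLocalization.algebraMap_mem_map_algebraMap_iff P.primeCompl]
  rfl

theorem comap_map_toZring {A : Ideal D} (hA : A.IsPrime) (hQA : Q ≤ A) (hAP : A ≤ P) :
    (A.map (toZring P Q hP)).comap (toZring P Q hP) = A := by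
  refine le_antisymm (fun a ha => ?_) Ideal.le_comap_map
  obtain ⟨s, hs, hsa⟩ := toZring_mem_map_iff.mp ha
  rw [sup_eq_left.mpr hQA] at hsa
  exact (hA.mem_or_mem hsa).resolve_left fun h => hs (hAP h)

theorem map_toZring_isPrime {A : Ideal D} (hA : A.IsPrime) (hQA : Q ≤ A) (hAP : A ≤ P) :
    (A.map (toZring P Q hP)).IsPrime := by
  rw [map_toZring]
  have : (A.map (algebraMap D (locRing D P hP))).IsPrime :=
    IsLocalization.isPrime_of_isPrime_disjoint P.primeCompl _ A hA
      (Set.disjoint_left.mpr fun x hx hxA => hx (hAP hxA))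
  refine Ideal.map_isPrime_of_surjective Ideal.Quotient.mk_surjective ?_
  rw [Ideal.mk_ker]
  exact Ideal.map_mono hQA

theorem map_toZring_self : Q.map (toZring P Q hP) = ⊥ := by
  rw [map_toZring, Ideal.map_quotient_self]

theorem comap_toZring_le {B : Ideal (Zring D P Q hP)} (hB : B ≠ ⊤) :
    B.comap (toZring P Q hP) ≤ P := by
  intro a ha
  by_contra haP
  have hu : IsUnit (toZring P Q hP a) :=
    (IsLocalization.map_units (locRing D P hP) (⟨a, haP⟩ : P.primeCompl)).map
      (Ideal.Quotient.mk (Q.map (algebraMap D (locRing D P hP))))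
  exact hB (Ideal.eq_top_of_isUnit_mem _ ha hu)

theorem image_comap_toZring (hQ : Q.IsPrime) (hQP : Q < P) :
    Ideal.comap (toZring P Q hP) '' {B | B.IsPrime ∧ B ≠ ⊥} =
      {A | A.IsPrime ∧ Q < A ∧ A ≤ P} := by
  ext A
  constructor
  · rintro ⟨B, ⟨hB, hB0⟩, rfl⟩
    refine ⟨hB.comap _, lt_of_le_of_ne ?_ ?_, comap_toZring_le hB.ne_top⟩
    · rw [← Ideal.map_le_iff_le_comap, map_toZring_self]
      exact bot_le
    · intro h
      apply hB0
      rw [← map_comap_toZring B, ← h, map_toZring_self]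
  · rintro ⟨hA, hQA, hAP⟩
    refine ⟨A.map (toZring P Q hP), ⟨map_toZring_isPrime hA hQA.le hAP, fun h => ?_⟩,
      comap_map_toZring hA hQA.le hAP⟩
    have h1 := comap_map_toZring (hP := hP) hA hQA.le hAP
    have h2 := comap_map_toZring (hP := hP) hQ le_rfl hQP.le
    rw [h, ← map_toZring_self, h2] at h1
    exact hQA.ne h1

theorem comap_toZring_injective : Function.Injective (Ideal.comap (toZring P Q hP)) :=
  Function.LeftInverse.injective (g := Ideal.map (toZring P Q hP)) map_comap_toZring

theorem LocallyTotal.sq_eq_iff_comap_toZring (h : LocallyTotal D) (hQ : Q.IsPrime)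
    {B : Ideal (Zring D P Q hP)} (hB : B.IsPrime) (hQB : Q < B.comap (toZring P Q hP)) :
    B * B = B ↔ B.comap (toZring P Q hP) * B.comap (toZring P Q hP) =
      B.comap (toZring P Q hP) := by
  have hm : B * B = (B.comap (toZring P Q hP) * B.comap (toZring P Q hP)).map (toZring P Q hP) := by
    rw [Ideal.map_mul, map_comap_toZring]
  constructor
  · intro hi
    refine le_antisymm Ideal.mul_le_left fun a ha => ?_
    have h1 : toZring P Q hP a ∈ B := ha
    rw [← hi, hm, toZring_mem_map_iff, sup_eq_left.mpr (h.le_sq_of_lt hQ hQB)] at h1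
    obtain ⟨s, hs, hsa⟩ := h1
    exact h.mem_sq_of_mul_mem (hB.comap _) ha (fun h' => hs (comap_toZring_le hB.ne_top h')) hsa
  · intro hi
    rw [hm, hi, map_comap_toZring]

theorem LocallyTotal.card_fracStar_Zring (h : LocallyTotal D) (hQ : Q.IsPrime) (hQP : Q < P)
    (hfin : {A : Ideal D | A.IsPrime ∧ Q < A ∧ A ≤ P}.Finite) :
    Nat.card (AFracStar (Zring D P Q hP)) = {A : Ideal D | A.IsPrime ∧ Q < A ∧ A ≤ P}.ncard +
      ({A : Ideal D | A.IsPrime ∧ Q < A ∧ A ≤ P} ∩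
        {A : Ideal D | A.IsPrime ∧ A ≠ ⊥ ∧ A * A = A}).ncard := by
  have hQmap : (Q.map (algebraMap D (locRing D P hP))).IsPrime :=
    IsLocalization.isPrime_of_isPrime_disjoint P.primeCompl _ Q hQ
      (Set.disjoint_left.mpr fun x hx hxQ => hx (hQP.le hxQ))
  have : IsDomain (Zring D P Q hP) := Ideal.Quotient.isDomain _
  have := h.preValuationRing_locRing hP
  have : PreValuationRing (Zring D P Q hP) :=
    Function.Surjective.preValuationRing
      (Ideal.Quotient.mk (Q.map (algebraMap D (locRing D P hP)))).toMonoidHom.toMulHom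
      Ideal.Quotient.mk_surjective
  have : ValuationRing (Zring D P Q hP) := ⟨⟩
  have himage := image_comap_toZring (hP := hP) hQ hQP
  have hV : ¬IsField (Zring D P Q hP) := by
    intro hF
    obtain ⟨B, ⟨hB, hB0⟩, -⟩ := himage.ge (show P ∈ _ from ⟨hP, hQP, le_rfl⟩)
    let := hF.toField
    exact (Ideal.eq_bot_or_top B).elim hB0 hB.ne_top
  have hfin' : {B : Ideal (Zring D P Q hP) | B.IsPrime ∧ B ≠ ⊥}.Finite :=
    Set.Finite.of_finite_image (himage ▸ hfin) comap_toZring_injective.injOn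
  have himage' : Ideal.comap (toZring P Q hP) '' {B | B.IsPrime ∧ B ≠ ⊥ ∧ B * B = B} =
      {A | A.IsPrime ∧ Q < A ∧ A ≤ P} ∩ {A | A.IsPrime ∧ A ≠ ⊥ ∧ A * A = A} := by
    ext A
    rw [← himage]
    constructor
    · rintro ⟨B, ⟨hB, hB0, hi⟩, rfl⟩
      have hmem := himage.le ⟨B, ⟨hB, hB0⟩, rfl⟩
      exact ⟨⟨B, ⟨hB, hB0⟩, rfl⟩, hmem.1, (bot_le.trans_lt hmem.2.1).ne',
        (h.sq_eq_iff_comap_toZring hQ hB hmem.2.1).mp hi⟩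
    · rintro ⟨⟨B, ⟨hB, hB0⟩, rfl⟩, -, -, hi⟩
      have hmem := himage.le ⟨B, ⟨hB, hB0⟩, rfl⟩
      exact ⟨B, ⟨hB, hB0, (h.sq_eq_iff_comap_toZring hQ hB hmem.2.1).mpr hi⟩, rfl⟩
  rw [card_fracStar hV hfin', ← himage', ← himage,
    Set.ncard_image_of_injective _ comap_toZring_injective,
    Set.ncard_image_of_injective _ comap_toZring_injective]

end Zring

end Prufer

end Paper

namespace Paper

/-- For `P ∈ hiSpec(D)` nonzero with `Q` directly below it, and
`Δ = {A ∈ Spec(D) : Q ⊊ A ⊆ P}`: `ω(P) = Σ_{A ∈ Δ} ε(A) = |Δ ∩ 𝒩| + 2|Δ ∩ ℐ|`,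
where `ℐ` (resp. `𝒩`) is the set of nonzero idempotent (resp. nonidempotent)
primes of `D`. -/
theorem statement13
    (D : Type*) [CommRing D] [IsDomain D]
    (K : Type*) [Field K] [Algebra D K] [IsFractionRing D K]
    (hPruf : IsPrufer D K) (hsl : IsSemilocal D) (hdim : ringKrullDim D < ⊤)
    (P Q : Ideal D) (hP : P ∈ hiSpec D) (hP0 : P ≠ ⊥)
    (hQ : DirectlyBelow D Q P) :
    (omegaAt D P Q (mem_hiSpec_prime hP) =
        ∑ᶠ A ∈ {A : Ideal D | A.IsPrime ∧ Q < A ∧ A ≤ P}, epsilonOf D A) ∧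
      omegaAt D P Q (mem_hiSpec_prime hP) =
        ({A : Ideal D | A.IsPrime ∧ Q < A ∧ A ≤ P} ∩
            {A : Ideal D | A.IsPrime ∧ A ≠ ⊥ ∧ A * A ≠ A}).ncard +
          2 * ({A : Ideal D | A.IsPrime ∧ Q < A ∧ A ≤ P} ∩
            {A : Ideal D | A.IsPrime ∧ A ≠ ⊥ ∧ A * A = A}).ncard := by
  classical
  have h : LocallyTotal D := fun R hR x y => hPruf.dvd_total hR x y
  have hfin : {A : Ideal D | A.IsPrime ∧ Q < A ∧ A ≤ P}.Finite :=
    (h.finite_primes_le hdim hP.1).subset fun A hA => ⟨hA.1, hA.2.2⟩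
  have hcard : omegaAt D P Q (mem_hiSpec_prime hP) =
      {A : Ideal D | A.IsPrime ∧ Q < A ∧ A ≤ P}.ncard +
        ({A : Ideal D | A.IsPrime ∧ Q < A ∧ A ≤ P} ∩
          {A : Ideal D | A.IsPrime ∧ A ≠ ⊥ ∧ A * A = A}).ncard :=
    h.card_fracStar_Zring hQ.1.1 hQ.2.2.1 hfin
  have h0 : ∀ A ∈ {A : Ideal D | A.IsPrime ∧ Q < A ∧ A ≤ P}, A ≠ ⊥ := fun A hA =>
    (bot_le.trans_lt hA.2.1).ne'
  constructor
  · rw [hcard, finsum_mem_congr rfl fun A hA => h.epsilonOf_eq hA.1 (h0 A hA),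
      finsum_mem_eq_finite_toFinset_sum _ hfin, Finset.sum_add_distrib, Finset.sum_const,
      smul_eq_mul, mul_one, ← Finset.card_filter, Set.ncard_eq_toFinset_card _ hfin,
      ← Set.ncard_coe_finset (Finset.filter _ _)]
    congr 2
    ext A
    simp only [Finset.coe_filter, Set.Finite.mem_toFinset]
    exact ⟨fun hA => ⟨hA.1, hA.2.2.2⟩, fun hA => ⟨hA.1, hA.1.1, h0 A hA.1, hA.2⟩⟩
  · rw [hcard, two_mul, ← add_assoc]
    congr 1
    rw [← Set.ncard_union_eq (Set.disjoint_left.mpr fun A hA hA' => hA.2.2.2 hA'.2.2.2)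
      (hfin.inter_of_left _) (hfin.inter_of_left _)]
    congr 1
    ext A
    constructor
    · intro hA
      by_cases hi : A * A = A
      · exact Or.inr ⟨hA, hA.1, h0 A hA, hi⟩
      · exact Or.inl ⟨hA, hA.1, h0 A hA, hi⟩
    · rintro (hA | hA) <;> exact hA.1

end Paper
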